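/- For every uncontrolled zone i = m+1,…,n, the zone savings are given exclusively by cross-zone heat transfer with the controlled zones: S_i = −Σ_{j=1}^m α_{ij} ∫_0^τ a_i(t) x_j(t) dt. In particular, if zone i has no direct thermal contact with any controlled zone (α_{ij} = 0 for j = 1,…,m), then S_i = 0. -/

import Mathlib

/-- For every uncontrolled zone `i = m+1,…,n`, the zone savings are
given exclusively by cross-zone heat transfer with the controlled zones:
`S_i = −Σ_{j=1}^m α_{ij} ∫_0^τ a_i(t) x_j(t) dt`. In particular, if zone `i` has no
direct thermal contact with any controlled zone, then `S_i = 0`. -/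
theorem uncontrolled_zone_savings
    (n m : ℕ) (hm : 1 ≤ m) (hmn : m ≤ n)
    (τ : ℝ) (hτ : 0 < τ)
    (T Tt q qt w : ℕ → ℝ → ℝ)
    (C : ℕ → ℝ) (α : ℕ → ℕ → ℝ) (a : ℕ → ℝ → ℝ)
    (hC : ∀ i, 0 < C i)
    (hα : ∀ i j, 0 ≤ α i j)
    (hsym : ∀ i j, α i j = α j i)
    (hq : ∀ i, Continuous (q i)) (hqt : ∀ i, Continuous (qt i))
    (ha : ∀ i, ContDiff ℝ 1 (a i))
    (hdyn : ∀ i ∈ Finset.Icc 1 n, ∀ t ∈ Set.Icc (0 : ℝ) τ,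
      HasDerivAt (T i)
        (((∑ j ∈ Finset.range (n + 1), α i j * (T j t - T i t)) + q i t + w i t) / C i) t)
    (hdynt : ∀ i ∈ Finset.Icc 1 n, ∀ t ∈ Set.Icc (0 : ℝ) τ,
      HasDerivAt (Tt i)
        (((∑ j ∈ Finset.range (n + 1), α i j * (Tt j t - Tt i t)) + qt i t + w i t) / C i) t)
    (hout : ∀ t, Tt 0 t = T 0 t)
    (hunc : ∀ i ∈ Finset.Icc (m + 1) n, ∀ t ∈ Set.Icc (0 : ℝ) τ, Tt i t = T i t)
    (hinit : ∀ i ∈ Finset.Icc 1 n, Tt i 0 = T i 0)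
    (hfin : ∀ i ∈ Finset.Icc 1 n, Tt i τ = T i τ) :
    ∀ i ∈ Finset.Icc (m + 1) n,
      ((∫ t in (0 : ℝ)..τ, a i t * (q i t - qt i t))
          = -∑ j ∈ Finset.Icc 1 m,
              α i j * ∫ t in (0 : ℝ)..τ, a i t * (T j t - Tt j t))
        ∧ ((∀ j ∈ Finset.Icc 1 m, α i j = 0) →
            (∫ t in (0 : ℝ)..τ, a i t * (q i t - qt i t)) = 0) := by
  intro i hi
  have hi' := Finset.mem_Icc.mp hi
  have hi1 : i ∈ Finset.Icc 1 n := Finset.mem_Icc.mpr ⟨by omega, hi'.2⟩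
  have key : ∀ t ∈ Set.Icc (0 : ℝ) τ,
      q i t - qt i t = -∑ j ∈ Finset.Icc 1 m, α i j * (T j t - Tt j t) := by
    intro t ht
    have h1 := (hdyn i hi1 t ht).hasDerivWithinAt (s := Set.Icc (0 : ℝ) τ)
    have h2 := (hdynt i hi1 t ht).hasDerivWithinAt (s := Set.Icc (0 : ℝ) τ)
    have h3 := h1.congr (fun x hx => hunc i hi x hx) (hunc i hi t ht)
    have h4 := (uniqueDiffOn_Icc hτ t ht).eq_deriv _ h2 h3
    have hCi := (hC i).ne'
    rw [div_left_inj' hCi] at h4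
    have h5 : ∑ j ∈ Finset.Icc 1 m, α i j * (T j t - Tt j t)
        = ∑ j ∈ Finset.range (n + 1), α i j * (T j t - Tt j t) := by
      apply Finset.sum_subset
      · intro j hj
        simp only [Finset.mem_Icc, Finset.mem_range] at hj ⊢
        omega
      · intro j hj hj'
        simp only [Finset.mem_Icc, Finset.mem_range] at hj hj'
        rcases Nat.eq_zero_or_pos j with h0 | h0
        · subst h0
          rw [hout t]; ring
        · rw [hunc j (Finset.mem_Icc.mpr ⟨by omega, by omega⟩) t ht]; ring
    have h6 : ∑ j ∈ Finset.range (n + 1), α i j * (T j t - Tt j t)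
        = ∑ j ∈ Finset.range (n + 1), α i j * (T j t - T i t)
          - ∑ j ∈ Finset.range (n + 1), α i j * (Tt j t - Tt i t) := by
      rw [← Finset.sum_sub_distrib]
      apply Finset.sum_congr rfl
      intro j _
      rw [hunc i hi t ht]; ring
    rw [h5, h6]
    linarith
  have main : (∫ t in (0 : ℝ)..τ, a i t * (q i t - qt i t))
          = -∑ j ∈ Finset.Icc 1 m,
              α i j * ∫ t in (0 : ℝ)..τ, a i t * (T j t - Tt j t) := by
    have e : (∫ t in (0 : ℝ)..τ, a i t * (q i t - qt i t))
        = ∫ t in (0 : ℝ)..τ, -∑ j ∈ Finset.Icc 1 m, α i j * (a i t * (T j t - Tt j t)) := by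
      apply intervalIntegral.integral_congr
      intro t ht
      rw [Set.uIcc_of_le hτ.le] at ht
      simp only
      rw [key t ht, mul_neg, Finset.mul_sum]
      congr 1
      apply Finset.sum_congr rfl
      intro j _
      ring
    rw [e, intervalIntegral.integral_neg, intervalIntegral.integral_finsetSum]
    · simp only [intervalIntegral.integral_const_mul]
    · intro j hj
      have hj1 : j ∈ Finset.Icc 1 n := by
        simp only [Finset.mem_Icc] at hj ⊢
        omega
      apply IntervalIntegrable.const_mul
      apply ContinuousOn.intervalIntegrable
      rw [Set.uIcc_of_le hτ.le]
      refine (ha i).continuous.continuousOn.mul (ContinuousOn.sub ?_ ?_)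
      · exact fun t ht => (hdyn j hj1 t ht).continuousAt.continuousWithinAt
      · exact fun t ht => (hdynt j hj1 t ht).continuousAt.continuousWithinAt
  refine ⟨main, fun h0 => ?_⟩
  rw [main, Finset.sum_eq_zero, neg_zero]
  intro j hj
  rw [h0 j hj, zero_mul]
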